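/- Let A and H each be simultaneously a Lie algebra and a Lie coalgebra, (A, H, ▷, ◁) a matched pair of Lie algebras and (A, H, φ, ψ) a matched pair of Lie coalgebras. Assume the double matched pair conditions: (BB5): δ_A(h ▷ a) = h ▷ a₁ ⊗ a₂ + a₁ ⊗ h ▷ a₂ + h₍₀₎ ▷ a ⊗ h₍₁₎ − h₍₁₎ ⊗ h₍₀₎ ▷ a; (BB6): δ_H(h ◁ a) = h₁ ⊗ h₂ ◁ a + h₁ ◁ a ⊗ h₂ + a₍₋₁₎ ⊗ h ◁ a₍₀₎ − h ◁ a₍₀₎ ⊗ a₍₋₁₎; (BB7): φ([a,b]) = a₍₋₁₎ ⊗ [a₍₀₎, b] + b₍₋₁₎ ⊗ [a, b₍₀₎] + a₍₋₁₎ ◁ b ⊗ a₍₀₎ − b₍₋₁₎ ◁ a ⊗ b₍₀₎; (BB8): ψ([h,g]) = [h, g₍₀₎] ⊗ g₍₁₎ + [h₍₀₎, g] ⊗ h₍₁₎ + g₍₀₎ ⊗ h ▷ g₍₁₎ − h₍₀₎ ⊗ g ▷ h₍₁₎; (YDB): φ(h ▷ a) + ψ(h ◁ a) = [h, a₍₋₁₎]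 ⊗ a₍₀₎ + a₍₋₁₎ ⊗ h ▷ a₍₀₎ + h₁ ⊗ h₂ ▷ a + h₍₀₎ ⊗ [h₍₁₎, a] + h₍₀₎ ◁ a ⊗ h₍₁₎ + h ◁ a₁ ⊗ a₂. Assume further the braided compatibility conditions (LBS for A): δ_A([a,b]) = [a,b₁] ⊗ b₂ + b₁ ⊗ [a,b₂] + a₁ ⊗ [a₂,b] + [a₁,b] ⊗ a₂ − (b₍₋₁₎ ▷ a ⊗ b₍₀₎ + a₍₀₎ ⊗ a₍₋₁₎ ▷ b − a₍₋₁₎ ▷ b ⊗ a₍₀₎ − b₍₀₎ ⊗ b₍₋₁₎ ▷ a), and (LBS for H): δ_H([h,g]) = [h,g₁] ⊗ g₂ + g₁ ⊗ [h,g₂] + h₁ ⊗ [h₂,g] + [h₁,g] ⊗ h₂ − (h₍₀₎ ⊗ g ◁ h₍₁₎ + h ◁ g₍₁₎ ⊗ g₍₀₎ − g₍₀₎ ⊗ h ◁ g₍₁₎ − g ◁ h₍₁₎ ⊗ h₍₀₎). Then the double cross biproduct A ·⊳◁· H, namely A ⊕ H with bracket [(a,h),(b,g)] = ([a,b] + h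 ▷ b − g ▷ a, [h,g] + h ◁ b − g ◁ a) and cobracket δ_D(a) = δ_A(a) + φ(a) − τφ(a), δ_D(h) = δ_H(h) + ψ(h) − τψ(h), is a Lie bialgebra. -/

import Mathlib

open TensorProduct

noncomputable section

variable {k : Type*} [Field k]
variable {A H : Type*} [AddCommGroup A] [Module k A] [AddCommGroup H] [Module k H]

/-- The cyclic rotation `ξ : u ⊗ v ⊗ w ↦ v ⊗ w ⊗ u` on `(L ⊗ L) ⊗ L`. -/
def ξmap (k L : Type*) [Field k] [AddCommGroup L] [Module k L] :
    ((L ⊗[k] L) ⊗[k] L) →ₗ[k] ((L ⊗[k] L) ⊗[k] L) :=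
  (TensorProduct.comm k L (L ⊗[k] L)).toLinearMap ∘ₗ (TensorProduct.assoc k L L L).toLinearMap

/-- Swap the last two tensor factors: `(m ⊗ n) ⊗ p ↦ (m ⊗ p) ⊗ n`. -/
def swapR (k M N P : Type*) [Field k] [AddCommGroup M] [Module k M] [AddCommGroup N]
    [Module k N] [AddCommGroup P] [Module k P] :
    ((M ⊗[k] N) ⊗[k] P) →ₗ[k] ((M ⊗[k] P) ⊗[k] N) :=
  (TensorProduct.assoc k M P N).symm.toLinearMap
    ∘ₗ TensorProduct.map LinearMap.id (TensorProduct.comm k N P).toLinearMap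
    ∘ₗ (TensorProduct.assoc k M N P).toLinearMap

/-- A bilinear bracket is a Lie algebra structure: antisymmetry and the Jacobi identity. -/
def IsLieAlg {L : Type*} [AddCommGroup L] [Module k L] (br : L →ₗ[k] L →ₗ[k] L) : Prop :=
  (∀ x y, br x y = - br y x) ∧
  (∀ x y z, br (br x y) z + br (br y z) x + br (br z x) y = 0)

/-- A cobracket is a Lie coalgebra structure: coanticommutativity `τ ∘ δ = −δ` and the
co-Jacobi identity `(id + ξ + ξ²) ∘ (δ ⊗ id) ∘ δ = 0`. -/
def IsLieCoalg {L : Type*} [AddCommGroup L] [Module k L] (δ : L →ₗ[k] L ⊗[k] L) : Prop :=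
  (∀ x, TensorProduct.comm k L L (δ x) = - δ x) ∧
  (∀ x, TensorProduct.map δ LinearMap.id (δ x)
      + ξmap k L (TensorProduct.map δ LinearMap.id (δ x))
      + ξmap k L (ξmap k L (TensorProduct.map δ LinearMap.id (δ x))) = 0)

/-- A Lie bialgebra: simultaneously a Lie algebra and a Lie coalgebra satisfying (LB):
`δ[x,y] = [x,y₁]⊗y₂ + y₁⊗[x,y₂] + x₁⊗[x₂,y] + [x₁,y]⊗x₂` (Sweedler notation). -/
def IsLieBialg {L : Type*} [AddCommGroup L] [Module k L]
    (br : L →ₗ[k] L →ₗ[k] L) (δ : L →ₗ[k] L ⊗[k] L) : Prop :=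
  IsLieAlg br ∧ IsLieCoalg δ ∧
  ∀ x y, δ (br x y)
      = TensorProduct.map (br x) LinearMap.id (δ y)
      + TensorProduct.map LinearMap.id (br x) (δ y)
      + TensorProduct.map LinearMap.id (br.flip y) (δ x)
      + TensorProduct.map (br.flip y) LinearMap.id (δ x)

/-- The bracket on the direct sum `A ⊕ H`:
`[(a,h),(b,g)] = ([a,b] + h▷b − g▷a + σ(h,g), [h,g] + h◁b − g◁a + θ(a,b))`. -/
def bbBracket (brA : A →ₗ[k] A →ₗ[k] A) (brH : H →ₗ[k] H →ₗ[k] H)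
    (r : H →ₗ[k] A →ₗ[k] A) (l : H →ₗ[k] A →ₗ[k] H)
    (σ : H →ₗ[k] H →ₗ[k] A) (θ : A →ₗ[k] A →ₗ[k] H) :
    (A × H) →ₗ[k] (A × H) →ₗ[k] (A × H) :=
  LinearMap.mk₂ k
    (fun x y => (brA x.1 y.1 + r x.2 y.1 - r y.2 x.1 + σ x.2 y.2,
                 brH x.2 y.2 + l x.2 y.1 - l y.2 x.1 + θ x.1 y.1))
    (fun x x' y => by
      simp only [Prod.fst_add, Prod.snd_add, map_add, LinearMap.add_apply, Prod.mk_add_mk,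
        Prod.mk.injEq]
      all_goals try (constructor <;> abel))
    (fun c x y => by
      simp only [Prod.smul_fst, Prod.smul_snd, map_smul, LinearMap.smul_apply, Prod.smul_mk,
        Prod.mk.injEq, smul_add, smul_sub]
      all_goals try (constructor <;> abel))
    (fun x y y' => by
      simp only [Prod.fst_add, Prod.snd_add, map_add, LinearMap.add_apply, Prod.mk_add_mk,
        Prod.mk.injEq]
      all_goals try (constructor <;> abel))
    (fun c x y => by
      simp only [Prod.smul_fst, Prod.smul_snd, map_smul, LinearMap.smul_apply, Prod.smul_mk,
        Prod.mk.injEq, smul_add, smul_sub]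
      all_goals try (constructor <;> abel))

/-- The cobracket on the direct sum `A ⊕ H`:
`δ_D(a) = δ_A(a) + φ(a) − τφ(a) + P(a)` and `δ_D(h) = δ_H(h) + ψ(h) − τψ(h) + Q(h)`,
all terms viewed inside `(A ⊕ H) ⊗ (A ⊕ H)`. -/
def bbCobracket (δA : A →ₗ[k] A ⊗[k] A) (δH : H →ₗ[k] H ⊗[k] H)
    (φ : A →ₗ[k] H ⊗[k] A) (ψ : H →ₗ[k] H ⊗[k] A)
    (P : A →ₗ[k] H ⊗[k] H) (Q : H →ₗ[k] A ⊗[k] A) :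
    (A × H) →ₗ[k] (A × H) ⊗[k] (A × H) :=
  (TensorProduct.map (LinearMap.inl k A H) (LinearMap.inl k A H) ∘ₗ δA
    + TensorProduct.map (LinearMap.inr k A H) (LinearMap.inl k A H) ∘ₗ φ
    - TensorProduct.map (LinearMap.inl k A H) (LinearMap.inr k A H)
        ∘ₗ (TensorProduct.comm k H A).toLinearMap ∘ₗ φ
    + TensorProduct.map (LinearMap.inr k A H) (LinearMap.inr k A H) ∘ₗ P) ∘ₗ LinearMap.fst k A H
  + (TensorProduct.map (LinearMap.inr k A H) (LinearMap.inr k A H) ∘ₗ δH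
    + TensorProduct.map (LinearMap.inr k A H) (LinearMap.inl k A H) ∘ₗ ψ
    - TensorProduct.map (LinearMap.inl k A H) (LinearMap.inr k A H)
        ∘ₗ (TensorProduct.comm k H A).toLinearMap ∘ₗ ψ
    + TensorProduct.map (LinearMap.inl k A H) (LinearMap.inl k A H) ∘ₗ Q) ∘ₗ LinearMap.snd k A H

section helpers

variable (k) in
/-- heterogeneous rotation -/
def rot3 (M N P : Type*) [AddCommGroup M] [Module k M] [AddCommGroup N]
    [Module k N] [AddCommGroup P] [Module k P] :
    ((M ⊗[k] N) ⊗[k] P) →ₗ[k] ((N ⊗[k] P) ⊗[k] M) :=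
  (TensorProduct.comm k M (N ⊗[k] P)).toLinearMap ∘ₗ (TensorProduct.assoc k M N P).toLinearMap

variable {M N P M' N' P' : Type*} [AddCommGroup M] [Module k M] [AddCommGroup N]
    [Module k N] [AddCommGroup P] [Module k P] [AddCommGroup M'] [Module k M'] [AddCommGroup N']
    [Module k N'] [AddCommGroup P'] [Module k P']

theorem rot3_rot3_rot3 (t : (M ⊗[k] N) ⊗[k] P) :
    rot3 k P M N (rot3 k N P M (rot3 k M N P t)) = t := by
  have : rot3 k P M N ∘ₗ rot3 k N P M ∘ₗ rot3 k M N P = LinearMap.id := by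
    apply TensorProduct.ext_threefold
    intro x y z
    simp [rot3]
  exact LinearMap.congr_fun this t

theorem ξmap_map {L : Type*} [AddCommGroup L] [Module k L]
    (f : M →ₗ[k] L) (g : N →ₗ[k] L) (h : P →ₗ[k] L) (t : (M ⊗[k] N) ⊗[k] P) :
    ξmap k L (TensorProduct.map (TensorProduct.map f g) h t)
      = TensorProduct.map (TensorProduct.map g h) f (rot3 k M N P t) := by
  have : ξmap k L ∘ₗ TensorProduct.map (TensorProduct.map f g) h
      = TensorProduct.map (TensorProduct.map g h) f ∘ₗ rot3 k M N P := by
    apply TensorProduct.ext_threefold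
    intro x y z
    simp [rot3, ξmap]
  exact LinearMap.congr_fun this t

theorem assoc_symm_map_id (f : M →ₗ[k] N ⊗[k] P) (t : M' ⊗[k] M) :
    (TensorProduct.assoc k M' N P).symm (TensorProduct.map LinearMap.id f t)
      = rot3 k P M' N (rot3 k N P M'
          (TensorProduct.map f LinearMap.id (TensorProduct.comm k M' M t))) := by
  induction t with
  | zero => simp
  | add x y hx hy => simp only [map_add, hx, hy]
  | tmul x y =>
    simp only [TensorProduct.map_tmul, TensorProduct.comm_tmul]
    generalize f y = u
    induction u with
    | zero => simp
    | add x y hx hy => simp only [map_add, hx, hy, TensorProduct.add_tmul, TensorProduct.tmul_add]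
    | tmul p q => simp [rot3]

theorem comm_rot_rot (f : M →ₗ[k] N ⊗[k] P) (t : M ⊗[k] M') :
    TensorProduct.map (TensorProduct.comm k M' N).toLinearMap LinearMap.id
      (rot3 k P M' N (rot3 k N P M' (TensorProduct.map f LinearMap.id t)))
    = rot3 k P N M' (TensorProduct.map ((TensorProduct.comm k N P).toLinearMap ∘ₗ f)
        LinearMap.id t) := by
  induction t with
  | zero => simp
  | add x y hx hy => simp only [map_add, hx, hy]
  | tmul x y =>
    simp only [TensorProduct.map_tmul, LinearMap.comp_apply]
    generalize f x = u
    induction u with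
    | zero => simp
    | add x y hx hy => simp only [map_add, hx, hy, TensorProduct.add_tmul]
    | tmul p q => simp [rot3]

theorem swapR_map (f : M →ₗ[k] N ⊗[k] P) (t : M ⊗[k] M') :
    swapR k N P M' (TensorProduct.map f LinearMap.id t)
    = rot3 k P N M' (TensorProduct.map ((TensorProduct.comm k N P).toLinearMap ∘ₗ f)
        LinearMap.id t) := by
  induction t with
  | zero => simp
  | add x y hx hy => simp only [map_add, hx, hy]
  | tmul x y =>
    simp only [TensorProduct.map_tmul, LinearMap.comp_apply]
    generalize f x = u
    induction u with
    | zero => simp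
    | add x y hx hy => simp only [map_add, hx, hy, TensorProduct.add_tmul]
    | tmul p q => simp [rot3, swapR]

theorem map_map_apply' (f : M →ₗ[k] M') (g : N →ₗ[k] N') {M'' N'' : Type*}
    [AddCommGroup M''] [Module k M''] [AddCommGroup N''] [Module k N'']
    (f' : M' →ₗ[k] M'') (g' : N' →ₗ[k] N'') (t : M ⊗[k] N) :
    TensorProduct.map f' g' (TensorProduct.map f g t)
      = TensorProduct.map (f' ∘ₗ f) (g' ∘ₗ g) t := by
  rw [TensorProduct.map_comp]; rfl

theorem comm_map' (f : M →ₗ[k] M') (g : N →ₗ[k] N') (t : M ⊗[k] N) :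
    TensorProduct.comm k M' N' (TensorProduct.map f g t)
      = TensorProduct.map g f (TensorProduct.comm k M N t) := by
  induction t with
  | zero => simp
  | add x y hx hy => simp only [map_add, hx, hy]
  | tmul x y => simp

theorem comm_comm' (t : M ⊗[k] N) :
    TensorProduct.comm k N M (TensorProduct.comm k M N t) = t := by
  induction t with
  | zero => simp
  | add x y hx hy => simp only [map_add, hx, hy]
  | tmul x y => simp

theorem map_sub_l (f f' : M →ₗ[k] M') (g : N →ₗ[k] N') (t : M ⊗[k] N) :
    TensorProduct.map (f - f') g t = TensorProduct.map f g t - TensorProduct.map f' g t := by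
  induction t with
  | zero => simp
  | add x y hx hy => simp only [map_add, hx, hy]; abel
  | tmul x y => simp [TensorProduct.sub_tmul]

theorem map_sub_r (f : M →ₗ[k] M') (g g' : N →ₗ[k] N') (t : M ⊗[k] N) :
    TensorProduct.map f (g - g') t = TensorProduct.map f g t - TensorProduct.map f g' t := by
  induction t with
  | zero => simp
  | add x y hx hy => simp only [map_add, hx, hy]; abel
  | tmul x y => simp [TensorProduct.tmul_sub]

theorem map_neg_l (f : M →ₗ[k] M') (g : N →ₗ[k] N') (t : M ⊗[k] N) :
    TensorProduct.map (-f) g t = -TensorProduct.map f g t := by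
  have := map_sub_l (0 : M →ₗ[k] M') f g t
  simpa using this

theorem map_neg_r (f : M →ₗ[k] M') (g : N →ₗ[k] N') (t : M ⊗[k] N) :
    TensorProduct.map f (-g) t = -TensorProduct.map f g t := by
  have := map_sub_r f (0 : N →ₗ[k] N') g t
  simpa using this

theorem map_add_l (f f' : M →ₗ[k] M') (g : N →ₗ[k] N') (t : M ⊗[k] N) :
    TensorProduct.map (f + f') g t = TensorProduct.map f g t + TensorProduct.map f' g t := by
  rw [TensorProduct.map_add_left]; rfl

theorem map_add_r (f : M →ₗ[k] M') (g g' : N →ₗ[k] N') (t : M ⊗[k] N) :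
    TensorProduct.map f (g + g') t = TensorProduct.map f g t + TensorProduct.map f g' t := by
  rw [TensorProduct.map_add_right]; rfl

theorem map_map_id_l {M'' : Type*} [AddCommGroup M''] [Module k M'']
    (f : M →ₗ[k] M') (f' : M' →ₗ[k] M'') (g : N →ₗ[k] N') (t : M ⊗[k] N) :
    TensorProduct.map (f' ∘ₗ f) g t
      = TensorProduct.map f' g (TensorProduct.map f LinearMap.id t) := by
  rw [map_map_apply']; rfl

theorem map_map_id_l' {Q : Type*} [AddCommGroup Q] [Module k Q]
    (f : M →ₗ[k] M' ⊗[k] P) (u : M' →ₗ[k] N') (v : P →ₗ[k] P') (g : N →ₗ[k] Q) (t : M ⊗[k] N) :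
    TensorProduct.map (TensorProduct.map u v ∘ₗ f) g t
      = TensorProduct.map (TensorProduct.map u v) g (TensorProduct.map f LinearMap.id t) :=
  map_map_id_l f _ g t

theorem split_prod (x : A × H) :
    x = LinearMap.inl k A H x.1 + LinearMap.inr k A H x.2 := by simp

theorem D_inl (δA : A →ₗ[k] A ⊗[k] A) (δH : H →ₗ[k] H ⊗[k] H)
    (φ : A →ₗ[k] H ⊗[k] A) (ψ : H →ₗ[k] H ⊗[k] A) (a : A) :
    bbCobracket δA δH φ ψ 0 0 (LinearMap.inl k A H a) =
      TensorProduct.map (LinearMap.inl k A H) (LinearMap.inl k A H) (δA a)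
    + TensorProduct.map (LinearMap.inr k A H) (LinearMap.inl k A H) (φ a)
    - TensorProduct.map (LinearMap.inl k A H) (LinearMap.inr k A H)
        (TensorProduct.comm k H A (φ a)) := by
  simp [bbCobracket]

theorem D_inr (δA : A →ₗ[k] A ⊗[k] A) (δH : H →ₗ[k] H ⊗[k] H)
    (φ : A →ₗ[k] H ⊗[k] A) (ψ : H →ₗ[k] H ⊗[k] A) (h : H) :
    bbCobracket δA δH φ ψ 0 0 (LinearMap.inr k A H h) =
      TensorProduct.map (LinearMap.inr k A H) (LinearMap.inr k A H) (δH h)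
    + TensorProduct.map (LinearMap.inr k A H) (LinearMap.inl k A H) (ψ h)
    - TensorProduct.map (LinearMap.inl k A H) (LinearMap.inr k A H)
        (TensorProduct.comm k H A (ψ h)) := by
  simp [bbCobracket]

theorem D_comp_inl (δA : A →ₗ[k] A ⊗[k] A) (δH : H →ₗ[k] H ⊗[k] H)
    (φ : A →ₗ[k] H ⊗[k] A) (ψ : H →ₗ[k] H ⊗[k] A) :
    bbCobracket δA δH φ ψ 0 0 ∘ₗ LinearMap.inl k A H =
      TensorProduct.map (LinearMap.inl k A H) (LinearMap.inl k A H) ∘ₗ δA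
    + TensorProduct.map (LinearMap.inr k A H) (LinearMap.inl k A H) ∘ₗ φ
    - TensorProduct.map (LinearMap.inl k A H) (LinearMap.inr k A H) ∘ₗ
        ((TensorProduct.comm k H A).toLinearMap ∘ₗ φ) := by
  apply LinearMap.ext; intro a
  exact D_inl δA δH φ ψ a

theorem D_comp_inr (δA : A →ₗ[k] A ⊗[k] A) (δH : H →ₗ[k] H ⊗[k] H)
    (φ : A →ₗ[k] H ⊗[k] A) (ψ : H →ₗ[k] H ⊗[k] A) :
    bbCobracket δA δH φ ψ 0 0 ∘ₗ LinearMap.inr k A H =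
      TensorProduct.map (LinearMap.inr k A H) (LinearMap.inr k A H) ∘ₗ δH
    + TensorProduct.map (LinearMap.inr k A H) (LinearMap.inl k A H) ∘ₗ ψ
    - TensorProduct.map (LinearMap.inl k A H) (LinearMap.inr k A H) ∘ₗ
        ((TensorProduct.comm k H A).toLinearMap ∘ₗ ψ) := by
  apply LinearMap.ext; intro a
  exact D_inr δA δH φ ψ a

section brackets
variable (brA : A →ₗ[k] A →ₗ[k] A) (brH : H →ₗ[k] H →ₗ[k] H)
    (r : H →ₗ[k] A →ₗ[k] A) (l : H →ₗ[k] A →ₗ[k] H)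

theorem br_ll (a b : A) : bbBracket brA brH r l 0 0 (LinearMap.inl k A H a) (LinearMap.inl k A H b)
    = LinearMap.inl k A H (brA a b) := by
  simp [bbBracket]

theorem br_rr (a b : H) : bbBracket brA brH r l 0 0 (LinearMap.inr k A H a) (LinearMap.inr k A H b)
    = LinearMap.inr k A H (brH a b) := by
  simp [bbBracket]

theorem br_rl (h : H) (b : A) :
    bbBracket brA brH r l 0 0 (LinearMap.inr k A H h) (LinearMap.inl k A H b)
    = LinearMap.inl k A H (r h b) + LinearMap.inr k A H (l h b) := by
  simp [bbBracket]

theorem br_lr (a : A) (g : H) :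
    bbBracket brA brH r l 0 0 (LinearMap.inl k A H a) (LinearMap.inr k A H g)
    = - (LinearMap.inl k A H (r g a) + LinearMap.inr k A H (l g a)) := by
  simp [bbBracket]

theorem brc_ll (a : A) : bbBracket brA brH r l 0 0 (LinearMap.inl k A H a) ∘ₗ LinearMap.inl k A H
    = LinearMap.inl k A H ∘ₗ brA a := LinearMap.ext fun b => br_ll brA brH r l a b

theorem brc_rr (a : H) : bbBracket brA brH r l 0 0 (LinearMap.inr k A H a) ∘ₗ LinearMap.inr k A H
    = LinearMap.inr k A H ∘ₗ brH a := LinearMap.ext fun b => br_rr brA brH r l a b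

theorem brc_rl (h : H) : bbBracket brA brH r l 0 0 (LinearMap.inr k A H h) ∘ₗ LinearMap.inl k A H
    = LinearMap.inl k A H ∘ₗ r h + LinearMap.inr k A H ∘ₗ l h :=
  LinearMap.ext fun b => br_rl brA brH r l h b

theorem brc_lr (a : A) : bbBracket brA brH r l 0 0 (LinearMap.inl k A H a) ∘ₗ LinearMap.inr k A H
    = -(LinearMap.inl k A H ∘ₗ r.flip a + LinearMap.inr k A H ∘ₗ l.flip a) :=
  LinearMap.ext fun b => br_lr brA brH r l a b

theorem brf_ll (a : A) :
    (bbBracket brA brH r l 0 0).flip (LinearMap.inl k A H a) ∘ₗ LinearMap.inl k A H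
    = LinearMap.inl k A H ∘ₗ brA.flip a := LinearMap.ext fun b => br_ll brA brH r l b a

theorem brf_rr (a : H) :
    (bbBracket brA brH r l 0 0).flip (LinearMap.inr k A H a) ∘ₗ LinearMap.inr k A H
    = LinearMap.inr k A H ∘ₗ brH.flip a := LinearMap.ext fun b => br_rr brA brH r l b a

theorem brf_rl (h : H) :
    (bbBracket brA brH r l 0 0).flip (LinearMap.inr k A H h) ∘ₗ LinearMap.inl k A H
    = -(LinearMap.inl k A H ∘ₗ r h + LinearMap.inr k A H ∘ₗ l h) :=
  LinearMap.ext fun b => br_lr brA brH r l b h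

theorem brf_lr (a : A) :
    (bbBracket brA brH r l 0 0).flip (LinearMap.inl k A H a) ∘ₗ LinearMap.inr k A H
    = LinearMap.inl k A H ∘ₗ r.flip a + LinearMap.inr k A H ∘ₗ l.flip a :=
  LinearMap.ext fun b => br_rl brA brH r l b a

end brackets

section abstractL
variable {L : Type*} [AddCommGroup L] [Module k L] (i : A →ₗ[k] L) (j : H →ₗ[k] L)
  (D : L →ₗ[k] L ⊗[k] L)
  (δA : A →ₗ[k] A ⊗[k] A) (δH : H →ₗ[k] H ⊗[k] H)
  (φ : A →ₗ[k] H ⊗[k] A) (ψ : H →ₗ[k] H ⊗[k] A)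

theorem coj_A
    (D_comp_inl : D ∘ₗ i = TensorProduct.map i i ∘ₗ δA + TensorProduct.map j i ∘ₗ φ
      - TensorProduct.map i j ∘ₗ ((TensorProduct.comm k H A).toLinearMap ∘ₗ φ))
    (D_comp_inr : D ∘ₗ j = TensorProduct.map j j ∘ₗ δH + TensorProduct.map j i ∘ₗ ψ
      - TensorProduct.map i j ∘ₗ ((TensorProduct.comm k H A).toLinearMap ∘ₗ ψ))
    (caA : ∀ x, TensorProduct.comm k A A (δA x) = - δA x)
    (cjA : ∀ x, TensorProduct.map δA LinearMap.id (δA x)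
      + ξmap k A (TensorProduct.map δA LinearMap.id (δA x))
      + ξmap k A (ξmap k A (TensorProduct.map δA LinearMap.id (δA x))) = 0)
    (hcomodA : (∀ a, TensorProduct.map δH LinearMap.id (φ a)
        = (TensorProduct.assoc k H H A).symm (TensorProduct.map LinearMap.id φ (φ a))
        - TensorProduct.map (TensorProduct.comm k H H).toLinearMap LinearMap.id
            ((TensorProduct.assoc k H H A).symm (TensorProduct.map LinearMap.id φ (φ a)))))
    (hBB3 : (∀ a, (TensorProduct.assoc k H A A).symm (TensorProduct.map LinearMap.id δA (φ a))
        = TensorProduct.map φ LinearMap.id (δA a)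
        + TensorProduct.map (TensorProduct.comm k A H).toLinearMap LinearMap.id
            ((TensorProduct.assoc k A H A).symm (TensorProduct.map LinearMap.id φ (δA a)))
        + TensorProduct.map ψ LinearMap.id (φ a)
        - swapR k H A A (TensorProduct.map ψ LinearMap.id (φ a))))
    (a : A) :
    TensorProduct.map D LinearMap.id (D (i a))
      + ξmap k L (TensorProduct.map D LinearMap.id (D (i a)))
      + ξmap k L (ξmap k L (TensorProduct.map D LinearMap.id (D (i a)))) = 0 := by
  have D_inl : D (i a) = TensorProduct.map i i (δA a) + TensorProduct.map j i (φ a)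
      - TensorProduct.map i j (TensorProduct.comm k H A (φ a)) :=
    LinearMap.congr_fun D_comp_inl a
  have e0 := congrArg (TensorProduct.map (TensorProduct.map i i) i) (cjA a)
  have e1 := hBB3 a
  have e2 := hcomodA a
  simp only [assoc_symm_map_id, comm_rot_rot, swapR_map, caA, map_neg] at e1 e2
  replace e1 := congrArg (TensorProduct.map (TensorProduct.map j i) i) e1
  replace e2 := congrArg (TensorProduct.map (TensorProduct.map j j) i) e2
  have e1' := congrArg (ξmap k L) e1
  have e1'' := congrArg (ξmap k L) e1'
  have e2' := congrArg (ξmap k L) e2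
  have e2'' := congrArg (ξmap k L) e2'
  have hx : ξmap k A = rot3 k A A A := rfl
  simp only [map_add, map_sub, map_neg, map_zero, ξmap_map, rot3_rot3_rot3, hx]
    at e0 e1 e1' e1'' e2 e2' e2''
  rw [D_inl]
  simp only [map_add, map_sub, map_map_apply', D_comp_inl, D_comp_inr,
    LinearMap.id_comp, map_add_l, map_sub_l]
  simp only [map_map_id_l', map_add, map_sub, ξmap_map]
  linear_combination (norm := module) e0 - e1 - e1' - e1'' + e2 + e2' + e2''

theorem coj_H
    (D_comp_inl : D ∘ₗ i = TensorProduct.map i i ∘ₗ δA + TensorProduct.map j i ∘ₗ φ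
      - TensorProduct.map i j ∘ₗ ((TensorProduct.comm k H A).toLinearMap ∘ₗ φ))
    (D_comp_inr : D ∘ₗ j = TensorProduct.map j j ∘ₗ δH + TensorProduct.map j i ∘ₗ ψ
      - TensorProduct.map i j ∘ₗ ((TensorProduct.comm k H A).toLinearMap ∘ₗ ψ))
    (caH : ∀ x, TensorProduct.comm k H H (δH x) = - δH x)
    (cjH : ∀ x, TensorProduct.map δH LinearMap.id (δH x)
      + ξmap k H (TensorProduct.map δH LinearMap.id (δH x))
      + ξmap k H (ξmap k H (TensorProduct.map δH LinearMap.id (δH x))) = 0)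
    (hcomodH : (∀ h, TensorProduct.map LinearMap.id δA (ψ h)
        = TensorProduct.assoc k H A A (TensorProduct.map ψ LinearMap.id (ψ h))
        - TensorProduct.map LinearMap.id (TensorProduct.comm k A A).toLinearMap
            (TensorProduct.assoc k H A A (TensorProduct.map ψ LinearMap.id (ψ h)))))
    (hBB4 : (∀ h, TensorProduct.map δH LinearMap.id (ψ h)
        = (TensorProduct.assoc k H H A).symm (TensorProduct.map LinearMap.id ψ (δH h))
        + swapR k H A H (TensorProduct.map ψ LinearMap.id (δH h))
        + (TensorProduct.assoc k H H A).symm (TensorProduct.map LinearMap.id φ (ψ h))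
        - TensorProduct.map (TensorProduct.comm k H H).toLinearMap LinearMap.id
            ((TensorProduct.assoc k H H A).symm (TensorProduct.map LinearMap.id φ (ψ h)))))
    (a : H) :
    TensorProduct.map D LinearMap.id (D (j a))
      + ξmap k L (TensorProduct.map D LinearMap.id (D (j a)))
      + ξmap k L (ξmap k L (TensorProduct.map D LinearMap.id (D (j a)))) = 0 := by
  have D_inr : D (j a) = TensorProduct.map j j (δH a) + TensorProduct.map j i (ψ a)
      - TensorProduct.map i j (TensorProduct.comm k H A (ψ a)) :=
    LinearMap.congr_fun D_comp_inr a
  have e0 := congrArg (TensorProduct.map (TensorProduct.map j j) j) (cjH a)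
  have e1 := congrArg (TensorProduct.assoc k H A A).symm (hcomodH a)
  have e2 := hBB4 a
  have hs : ∀ t, (TensorProduct.assoc k H A A).symm (TensorProduct.map LinearMap.id
      (TensorProduct.comm k A A).toLinearMap (TensorProduct.assoc k H A A t))
      = swapR k H A A t := fun t => rfl
  rw [map_sub, hs, LinearEquiv.symm_apply_apply] at e1
  simp only [assoc_symm_map_id, comm_rot_rot, swapR_map, caH, map_neg] at e1 e2
  replace e1 := congrArg (TensorProduct.map (TensorProduct.map j i) i) e1
  replace e2 := congrArg (TensorProduct.map (TensorProduct.map j j) i) e2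
  have e1' := congrArg (ξmap k L) e1
  have e1'' := congrArg (ξmap k L) e1'
  have e2' := congrArg (ξmap k L) e2
  have e2'' := congrArg (ξmap k L) e2'
  have hx : ξmap k H = rot3 k H H H := rfl
  simp only [map_add, map_sub, map_neg, map_zero, ξmap_map, rot3_rot3_rot3, hx]
    at e0 e1 e1' e1'' e2 e2' e2''
  rw [D_inr]
  simp only [map_add, map_sub, map_map_apply', D_comp_inl, D_comp_inr,
    LinearMap.id_comp, map_add_l, map_sub_l]
  simp only [map_map_id_l', map_add, map_sub, ξmap_map]
  linear_combination (norm := module) e0 - e1 - e1' - e1'' + e2 + e2' + e2''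

theorem coj_add (hA : ∀ a : A, TensorProduct.map D LinearMap.id (D (i a))
      + ξmap k L (TensorProduct.map D LinearMap.id (D (i a)))
      + ξmap k L (ξmap k L (TensorProduct.map D LinearMap.id (D (i a)))) = 0)
    (hH : ∀ a : H, TensorProduct.map D LinearMap.id (D (j a))
      + ξmap k L (TensorProduct.map D LinearMap.id (D (j a)))
      + ξmap k L (ξmap k L (TensorProduct.map D LinearMap.id (D (j a)))) = 0)
    (x : L) (a : A) (h : H) (hx : x = i a + j h) :
    TensorProduct.map D LinearMap.id (D x)
      + ξmap k L (TensorProduct.map D LinearMap.id (D x))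
      + ξmap k L (ξmap k L (TensorProduct.map D LinearMap.id (D x))) = 0 := by
  subst hx
  have k1 := hA a
  have k2 := hH h
  simp only [map_add]
  linear_combination (norm := module) k1 + k2

variable (br : L →ₗ[k] L →ₗ[k] L)

/-- The compatibility condition at a pair of elements. -/
def LBat (x y : L) : Prop := D (br x y)
      = TensorProduct.map (br x) LinearMap.id (D y)
      + TensorProduct.map LinearMap.id (br x) (D y)
      + TensorProduct.map LinearMap.id (br.flip y) (D x)
      + TensorProduct.map (br.flip y) LinearMap.id (D x)

theorem LBat_add_left {x x' y : L} (h : LBat D br x y) (h' : LBat D br x' y) :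
    LBat D br (x + x') y := by
  unfold LBat at *
  simp only [map_add, LinearMap.add_apply, map_add_l, map_add_r, h, h']
  abel

theorem LBat_add_right {x y y' : L} (h : LBat D br x y) (h' : LBat D br x y') :
    LBat D br x (y + y') := by
  unfold LBat at *
  simp only [map_add, map_add_l, map_add_r, h, h']
  abel

theorem LBat_swap (hbr : ∀ x y, br x y = - br y x) {x y : L} (h : LBat D br x y) :
    LBat D br y x := by
  unfold LBat at *
  have f1 : ∀ z, br.flip z = - br z := fun z => LinearMap.ext fun w => hbr w z
  rw [hbr y x, map_neg, h]
  simp only [f1, map_neg_l, map_neg_r]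
  abel

variable (brA : A →ₗ[k] A →ₗ[k] A) (brH : H →ₗ[k] H →ₗ[k] H)
    (r : H →ₗ[k] A →ₗ[k] A) (l : H →ₗ[k] A →ₗ[k] H)

theorem LB_AA
    (D_inl : ∀ a, D (i a) = TensorProduct.map i i (δA a) + TensorProduct.map j i (φ a)
      - TensorProduct.map i j (TensorProduct.comm k H A (φ a)))
    (b_ll : ∀ a b, br (i a) (i b) = i (brA a b))
    (b_rl : ∀ h b, br (j h) (i b) = i (r h b) + j (l h b))
    (b_lr : ∀ a g, br (i a) (j g) = -(i (r g a) + j (l g a)))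
    (hBB7 : ∀ a b, φ (brA a b)
        = TensorProduct.map LinearMap.id (brA.flip b) (φ a)
        + TensorProduct.map LinearMap.id (brA a) (φ b)
        + TensorProduct.map (l.flip b) LinearMap.id (φ a)
        - TensorProduct.map (l.flip a) LinearMap.id (φ b))
    (hLBSA : ∀ a b, δA (brA a b)
        = TensorProduct.map (brA a) LinearMap.id (δA b)
        + TensorProduct.map LinearMap.id (brA a) (δA b)
        + TensorProduct.map LinearMap.id (brA.flip b) (δA a)
        + TensorProduct.map (brA.flip b) LinearMap.id (δA a)
        - (TensorProduct.map (r.flip a) LinearMap.id (φ b)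
          + TensorProduct.map LinearMap.id (r.flip b) (TensorProduct.comm k H A (φ a))
          - TensorProduct.map (r.flip b) LinearMap.id (φ a)
          - TensorProduct.map LinearMap.id (r.flip a) (TensorProduct.comm k H A (φ b))))
    (a b : A) : LBat D br (i a) (i b) := by
  have c1 : ∀ a, br (i a) ∘ₗ i = i ∘ₗ brA a := fun a => LinearMap.ext fun b => b_ll a b
  have c2 : ∀ a, br.flip (i a) ∘ₗ i = i ∘ₗ brA.flip a := fun a => LinearMap.ext fun b => b_ll b a
  have c3 : ∀ a, br (i a) ∘ₗ j = -(i ∘ₗ r.flip a + j ∘ₗ l.flip a) :=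
    fun a => LinearMap.ext fun b => b_lr a b
  have c4 : ∀ a, br.flip (i a) ∘ₗ j = i ∘ₗ r.flip a + j ∘ₗ l.flip a :=
    fun a => LinearMap.ext fun b => b_rl b a
  unfold LBat
  rw [b_ll]
  simp only [D_inl, hLBSA, hBB7, map_add, map_sub, comm_map', map_map_apply', c1, c2, c3, c4,
    LinearMap.id_comp, LinearMap.comp_id, map_neg_l, map_neg_r, map_add_l, map_add_r]
  abel

theorem LB_HH
    (D_inr : ∀ a, D (j a) = TensorProduct.map j j (δH a) + TensorProduct.map j i (ψ a)
      - TensorProduct.map i j (TensorProduct.comm k H A (ψ a)))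
    (b_rr : ∀ a b, br (j a) (j b) = j (brH a b))
    (b_rl : ∀ h b, br (j h) (i b) = i (r h b) + j (l h b))
    (b_lr : ∀ a g, br (i a) (j g) = -(i (r g a) + j (l g a)))
    (hBB8 : ∀ h g, ψ (brH h g)
        = TensorProduct.map (brH h) LinearMap.id (ψ g)
        + TensorProduct.map (brH.flip g) LinearMap.id (ψ h)
        + TensorProduct.map LinearMap.id (r h) (ψ g)
        - TensorProduct.map LinearMap.id (r g) (ψ h))
    (hLBSH : ∀ h g, δH (brH h g)
        = TensorProduct.map (brH h) LinearMap.id (δH g)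
        + TensorProduct.map LinearMap.id (brH h) (δH g)
        + TensorProduct.map LinearMap.id (brH.flip g) (δH h)
        + TensorProduct.map (brH.flip g) LinearMap.id (δH h)
        - (TensorProduct.map LinearMap.id (l g) (ψ h)
          + TensorProduct.map (l h) LinearMap.id (TensorProduct.comm k H A (ψ g))
          - TensorProduct.map LinearMap.id (l h) (ψ g)
          - TensorProduct.map (l g) LinearMap.id (TensorProduct.comm k H A (ψ h))))
    (h g : H) : LBat D br (j h) (j g) := by
  have c1 : ∀ a, br (j a) ∘ₗ j = j ∘ₗ brH a := fun a => LinearMap.ext fun b => b_rr a b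
  have c2 : ∀ a, br.flip (j a) ∘ₗ j = j ∘ₗ brH.flip a := fun a => LinearMap.ext fun b => b_rr b a
  have c3 : ∀ h, br (j h) ∘ₗ i = i ∘ₗ r h + j ∘ₗ l h :=
    fun a => LinearMap.ext fun b => b_rl a b
  have c4 : ∀ h, br.flip (j h) ∘ₗ i = -(i ∘ₗ r h + j ∘ₗ l h) :=
    fun a => LinearMap.ext fun b => b_lr b a
  unfold LBat
  rw [b_rr]
  simp only [D_inr, hLBSH, hBB8, map_add, map_sub, comm_map', map_map_apply', c1, c2, c3, c4,
    LinearMap.id_comp, LinearMap.comp_id, map_neg_l, map_neg_r, map_add_l, map_add_r]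
  abel

theorem LB_HA
    (D_inl : ∀ a, D (i a) = TensorProduct.map i i (δA a) + TensorProduct.map j i (φ a)
      - TensorProduct.map i j (TensorProduct.comm k H A (φ a)))
    (D_inr : ∀ a, D (j a) = TensorProduct.map j j (δH a) + TensorProduct.map j i (ψ a)
      - TensorProduct.map i j (TensorProduct.comm k H A (ψ a)))
    (b_ll : ∀ a b, br (i a) (i b) = i (brA a b))
    (b_rr : ∀ a b, br (j a) (j b) = j (brH a b))
    (b_rl : ∀ h b, br (j h) (i b) = i (r h b) + j (l h b))
    (caA : ∀ x, TensorProduct.comm k A A (δA x) = - δA x)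
    (caH : ∀ x, TensorProduct.comm k H H (δH x) = - δH x)
    (hBB5 : ∀ h a, δA (r h a)
        = TensorProduct.map (r h) LinearMap.id (δA a)
        + TensorProduct.map LinearMap.id (r h) (δA a)
        + TensorProduct.map (r.flip a) LinearMap.id (ψ h)
        - TensorProduct.map LinearMap.id (r.flip a) (TensorProduct.comm k H A (ψ h)))
    (hBB6 : ∀ h a, δH (l h a)
        = TensorProduct.map LinearMap.id (l.flip a) (δH h)
        + TensorProduct.map (l.flip a) LinearMap.id (δH h)
        + TensorProduct.map LinearMap.id (l h) (φ a)
        - TensorProduct.map (l h) LinearMap.id (TensorProduct.comm k H A (φ a)))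
    (hYDB : ∀ h a, φ (r h a) + ψ (l h a)
        = TensorProduct.map (brH h) LinearMap.id (φ a)
        + TensorProduct.map LinearMap.id (r h) (φ a)
        + TensorProduct.map LinearMap.id (r.flip a) (δH h)
        + TensorProduct.map LinearMap.id (brA.flip a) (ψ h)
        + TensorProduct.map (l.flip a) LinearMap.id (ψ h)
        + TensorProduct.map (l h) LinearMap.id (δA a))
    (h : H) (a : A) : LBat D br (j h) (i a) := by
  have c1 : ∀ a, br.flip (i a) ∘ₗ i = i ∘ₗ brA.flip a := fun a => LinearMap.ext fun b => b_ll b a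
  have c2 : ∀ a, br (j a) ∘ₗ j = j ∘ₗ brH a := fun a => LinearMap.ext fun b => b_rr a b
  have c3 : ∀ h, br (j h) ∘ₗ i = i ∘ₗ r h + j ∘ₗ l h :=
    fun a => LinearMap.ext fun b => b_rl a b
  have c4 : ∀ a, br.flip (i a) ∘ₗ j = i ∘ₗ r.flip a + j ∘ₗ l.flip a :=
    fun a => LinearMap.ext fun b => b_rl b a
  have y1 := congrArg (TensorProduct.map j i) (hYDB h a)
  have y3 := congrArg (TensorProduct.comm k _ _) y1
  simp only [map_add, map_neg, comm_map', caA, caH, map_map_apply', LinearMap.comp_id]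
    at y1 y3
  unfold LBat
  rw [b_rl]
  simp only [D_inl, D_inr, hBB5, hBB6, map_add, map_sub, comm_map', map_map_apply', c1, c2, c3, c4,
    LinearMap.id_comp, LinearMap.comp_id, map_add_l, map_add_r]
  linear_combination (norm := module) y1 - y3

end abstractL

end helpers

/-- Given a double matched pair: a matched pair of Lie algebras and a
matched pair of Lie coalgebras on `(A, H)` satisfying (BB5)–(BB8), (YDB), with `A` and `H`
braided Lie bialgebras ((LBS) for `A` and for `H`), the double cross biproduct `A ·⊳◁· H`
is a Lie bialgebra. -/
theorem double_cross_biproduct_is_lie_bialgebra [CharZero k]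
    (brA : A →ₗ[k] A →ₗ[k] A) (δA : A →ₗ[k] A ⊗[k] A)
    (brH : H →ₗ[k] H →ₗ[k] H) (δH : H →ₗ[k] H ⊗[k] H)
    (r : H →ₗ[k] A →ₗ[k] A) (l : H →ₗ[k] A →ₗ[k] H)
    (φ : A →ₗ[k] H ⊗[k] A) (ψ : H →ₗ[k] H ⊗[k] A)
    -- `A`, `H` are simultaneously Lie algebras and Lie coalgebras
    (haA : IsLieAlg brA) (haH : IsLieAlg brH)
    (hcA : IsLieCoalg δA) (hcH : IsLieCoalg δH)
    -- matched pair of Lie algebras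
    (hmodA : ∀ h g a, r (brH h g) a = r h (r g a) - r g (r h a))
    (hmodH : ∀ h a b, l h (brA a b) = l (l h a) b - l (l h b) a)
    (hBB1 : ∀ h a b, r h (brA a b)
        = brA (r h a) b + brA a (r h b) + r (l h a) b - r (l h b) a)
    (hBB2 : ∀ h g a, l (brH h g) a
        = brH h (l g a) + brH (l h a) g + l h (r g a) - l g (r h a))
    -- matched pair of Lie coalgebras
    (hcomodA : (∀ a, TensorProduct.map δH LinearMap.id (φ a)
        = (TensorProduct.assoc k H H A).symm (TensorProduct.map LinearMap.id φ (φ a))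
        - TensorProduct.map (TensorProduct.comm k H H).toLinearMap LinearMap.id
            ((TensorProduct.assoc k H H A).symm (TensorProduct.map LinearMap.id φ (φ a)))))
    (hcomodH : (∀ h, TensorProduct.map LinearMap.id δA (ψ h)
        = TensorProduct.assoc k H A A (TensorProduct.map ψ LinearMap.id (ψ h))
        - TensorProduct.map LinearMap.id (TensorProduct.comm k A A).toLinearMap
            (TensorProduct.assoc k H A A (TensorProduct.map ψ LinearMap.id (ψ h)))))
    (hBB3 : (∀ a, (TensorProduct.assoc k H A A).symm (TensorProduct.map LinearMap.id δA (φ a))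
        = TensorProduct.map φ LinearMap.id (δA a)
        + TensorProduct.map (TensorProduct.comm k A H).toLinearMap LinearMap.id
            ((TensorProduct.assoc k A H A).symm (TensorProduct.map LinearMap.id φ (δA a)))
        + TensorProduct.map ψ LinearMap.id (φ a)
        - swapR k H A A (TensorProduct.map ψ LinearMap.id (φ a))))
    (hBB4 : (∀ h, TensorProduct.map δH LinearMap.id (ψ h)
        = (TensorProduct.assoc k H H A).symm (TensorProduct.map LinearMap.id ψ (δH h))
        + swapR k H A H (TensorProduct.map ψ LinearMap.id (δH h))
        + (TensorProduct.assoc k H H A).symm (TensorProduct.map LinearMap.id φ (ψ h))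
        - TensorProduct.map (TensorProduct.comm k H H).toLinearMap LinearMap.id
            ((TensorProduct.assoc k H H A).symm (TensorProduct.map LinearMap.id φ (ψ h)))))
    -- (BB5) : `δ_A(h▷a) = h▷a₁ ⊗ a₂ + a₁ ⊗ h▷a₂ + h₍₀₎▷a ⊗ h₍₁₎ − h₍₁₎ ⊗ h₍₀₎▷a`
    (hBB5 : ∀ h a, δA (r h a)
        = TensorProduct.map (r h) LinearMap.id (δA a)
        + TensorProduct.map LinearMap.id (r h) (δA a)
        + TensorProduct.map (r.flip a) LinearMap.id (ψ h)
        - TensorProduct.map LinearMap.id (r.flip a) (TensorProduct.comm k H A (ψ h)))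
    -- (BB6) : `δ_H(h◁a) = h₁ ⊗ h₂◁a + h₁◁a ⊗ h₂ + a₍₋₁₎ ⊗ h◁a₍₀₎ − h◁a₍₀₎ ⊗ a₍₋₁₎`
    (hBB6 : ∀ h a, δH (l h a)
        = TensorProduct.map LinearMap.id (l.flip a) (δH h)
        + TensorProduct.map (l.flip a) LinearMap.id (δH h)
        + TensorProduct.map LinearMap.id (l h) (φ a)
        - TensorProduct.map (l h) LinearMap.id (TensorProduct.comm k H A (φ a)))
    -- (BB7) : `φ([a,b]) = a₍₋₁₎ ⊗ [a₍₀₎,b] + b₍₋₁₎ ⊗ [a,b₍₀₎] + a₍₋₁₎◁b ⊗ a₍₀₎ − b₍₋₁₎◁a ⊗ b₍₀₎`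
    (hBB7 : ∀ a b, φ (brA a b)
        = TensorProduct.map LinearMap.id (brA.flip b) (φ a)
        + TensorProduct.map LinearMap.id (brA a) (φ b)
        + TensorProduct.map (l.flip b) LinearMap.id (φ a)
        - TensorProduct.map (l.flip a) LinearMap.id (φ b))
    -- (BB8) : `ψ([h,g]) = [h,g₍₀₎] ⊗ g₍₁₎ + [h₍₀₎,g] ⊗ h₍₁₎ + g₍₀₎ ⊗ h▷g₍₁₎ − h₍₀₎ ⊗ g▷h₍₁₎`
    (hBB8 : ∀ h g, ψ (brH h g)
        = TensorProduct.map (brH h) LinearMap.id (ψ g)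
        + TensorProduct.map (brH.flip g) LinearMap.id (ψ h)
        + TensorProduct.map LinearMap.id (r h) (ψ g)
        - TensorProduct.map LinearMap.id (r g) (ψ h))
    -- (YDB) : `φ(h▷a) + ψ(h◁a) = [h,a₍₋₁₎] ⊗ a₍₀₎ + a₍₋₁₎ ⊗ h▷a₍₀₎ + h₁ ⊗ h₂▷a`
    --         `+ h₍₀₎ ⊗ [h₍₁₎,a] + h₍₀₎◁a ⊗ h₍₁₎ + h◁a₁ ⊗ a₂`
    (hYDB : ∀ h a, φ (r h a) + ψ (l h a)
        = TensorProduct.map (brH h) LinearMap.id (φ a)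
        + TensorProduct.map LinearMap.id (r h) (φ a)
        + TensorProduct.map LinearMap.id (r.flip a) (δH h)
        + TensorProduct.map LinearMap.id (brA.flip a) (ψ h)
        + TensorProduct.map (l.flip a) LinearMap.id (ψ h)
        + TensorProduct.map (l h) LinearMap.id (δA a))
    -- (LBS) for `A` : `δ_A([a,b]) = [a,b₁]⊗b₂ + b₁⊗[a,b₂] + a₁⊗[a₂,b] + [a₁,b]⊗a₂ − s(a⊗b)`
    (hLBSA : ∀ a b, δA (brA a b)
        = TensorProduct.map (brA a) LinearMap.id (δA b)
        + TensorProduct.map LinearMap.id (brA a) (δA b)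
        + TensorProduct.map LinearMap.id (brA.flip b) (δA a)
        + TensorProduct.map (brA.flip b) LinearMap.id (δA a)
        - (TensorProduct.map (r.flip a) LinearMap.id (φ b)
          + TensorProduct.map LinearMap.id (r.flip b) (TensorProduct.comm k H A (φ a))
          - TensorProduct.map (r.flip b) LinearMap.id (φ a)
          - TensorProduct.map LinearMap.id (r.flip a) (TensorProduct.comm k H A (φ b))))
    -- (LBS) for `H` : `δ_H([h,g]) = [h,g₁]⊗g₂ + g₁⊗[h,g₂] + h₁⊗[h₂,g] + [h₁,g]⊗h₂ − s(h⊗g)`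
    (hLBSH : ∀ h g, δH (brH h g)
        = TensorProduct.map (brH h) LinearMap.id (δH g)
        + TensorProduct.map LinearMap.id (brH h) (δH g)
        + TensorProduct.map LinearMap.id (brH.flip g) (δH h)
        + TensorProduct.map (brH.flip g) LinearMap.id (δH h)
        - (TensorProduct.map LinearMap.id (l g) (ψ h)
          + TensorProduct.map (l h) LinearMap.id (TensorProduct.comm k H A (ψ g))
          - TensorProduct.map LinearMap.id (l h) (ψ g)
          - TensorProduct.map (l g) LinearMap.id (TensorProduct.comm k H A (ψ h)))) :
    IsLieBialg (bbBracket brA brH r l 0 0) (bbCobracket δA δH φ ψ 0 0) := by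
  obtain ⟨asA, jacA⟩ := haA
  obtain ⟨asH, jacH⟩ := haH
  obtain ⟨caA, cjA⟩ := hcA
  obtain ⟨caH, cjH⟩ := hcH
  refine ⟨⟨?_, ?_⟩, ⟨?_, ?_⟩, ?_⟩
  · rintro ⟨a, h⟩ ⟨b, g⟩
    simp only [bbBracket, LinearMap.mk₂_apply, LinearMap.zero_apply, Prod.neg_mk, Prod.mk.injEq]
    rw [asA a b, asH h g]
    constructor <;> abel
  · rintro ⟨a, h⟩ ⟨b, g⟩ ⟨c, f⟩
    simp only [bbBracket, LinearMap.mk₂_apply, LinearMap.zero_apply, Prod.mk_add_mk,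
      Prod.mk_eq_zero, map_add, map_sub, LinearMap.add_apply, LinearMap.sub_apply, add_zero,
      hmodA, hmodH, hBB1, hBB2]
    constructor
    · have e1 := jacA a b c
      rw [asA (r h b) c, asA (r g a) c, asA (r g c) a, asA (r f b) a, asA (r f a) b,
        asA (r h c) b]
      linear_combination (norm := module) e1
    · have e1 := jacH h g f
      rw [asH (l h b) f, asH (l g a) f, asH (l g c) h, asH (l f b) h, asH (l f a) g,
        asH (l h c) g]
      linear_combination (norm := module) e1
  · intro x
    rw [split_prod (k := k) x]
    simp only [map_add, map_sub, D_inl, D_inr, comm_map', comm_comm', caA, caH, map_neg]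
    abel
  · intro x
    exact coj_add _ _ _
      (coj_A _ _ _ δA δH φ ψ (D_comp_inl δA δH φ ψ) (D_comp_inr δA δH φ ψ) caA cjA hcomodA hBB3)
      (coj_H _ _ _ δA δH φ ψ (D_comp_inl δA δH φ ψ) (D_comp_inr δA δH φ ψ) caH cjH hcomodH hBB4)
      x x.1 x.2 (split_prod x)
  · intro x y
    have hsw : ∀ x y, bbBracket brA brH r l 0 0 x y = - bbBracket brA brH r l 0 0 y x := by
      rintro ⟨a, h⟩ ⟨b, g⟩
      simp only [bbBracket, LinearMap.mk₂_apply, LinearMap.zero_apply, Prod.neg_mk, Prod.mk.injEq]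
      rw [asA a b, asH h g]
      constructor <;> abel
    have hAA := LB_AA _ _ _ δA φ _ brA r l (D_inl δA δH φ ψ) (br_ll brA brH r l)
      (br_rl brA brH r l) (br_lr brA brH r l) hBB7 hLBSA
    have hHH := LB_HH _ _ _ δH ψ _ brH r l (D_inr δA δH φ ψ) (br_rr brA brH r l)
      (br_rl brA brH r l) (br_lr brA brH r l) hBB8 hLBSH
    have hHA := LB_HA _ _ _ δA δH φ ψ _ brA brH r l (D_inl δA δH φ ψ) (D_inr δA δH φ ψ)
      (br_ll brA brH r l) (br_rr brA brH r l) (br_rl brA brH r l) caA caH hBB5 hBB6 hYDB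
    have main : LBat (bbCobracket δA δH φ ψ 0 0) (bbBracket brA brH r l 0 0) x y := by
      rw [split_prod (k := k) x, split_prod (k := k) y]
      exact LBat_add_left _ _
        (LBat_add_right _ _ (hAA _ _) (LBat_swap _ _ hsw (hHA _ _)))
        (LBat_add_right _ _ (hHA _ _) (hHH _ _))
    exact main

end
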